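/- Assume (H1): Ã > 0, C̃ > 0, f(r)/r < π/Ã, and f(Rφ(β))/R > 1/(2φ(β)C̃); and assume (H4): g(t) = 0 for all t ∈ [0,β]; f is twice continuously differentiable on [rφ(β), R] with f''(t) ≥ M for some M > 0 and all t ∈ [rφ(β), R]; and there exists a continuous function θ̃ : [rφ(β), R] → ℝ with θ̃(t) > 0 such that t f'(t) − f(t) ≥ θ̃(t) for all t ∈ [rφ(β), R]. Then there exists u* ∈ K with r < ‖u*‖ < R satisfying u*(t) = ∫₀¹ G(t,s) f(u*(s)) g(s) ds for all t ∈ [0,1]; that is, u* is a positive symmetric solution of the Dirichlet problem −u'' = g f(u) on [0,1], u(0) = u(1) = 0, localized in the annular conical set { u ∈ K : r < ‖u‖ < R }. -/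

import Mathlib

open Set

/-- `φ(t) = t(1-2t)`. -/
noncomputable def phi (t : ℝ) : ℝ := t * (1 - 2 * t)

/-- The `H¹₀` (energetic) norm `‖u‖ = (∫₀¹ u'(t)² dt)^{1/2}`. -/
noncomputable def normH (u : ℝ → ℝ) : ℝ := Real.sqrt (∫ t in (0:ℝ)..1, deriv u t ^ 2)

/-- Membership in the cone `K`: continuously differentiable on `[0,1]`, vanishing at the
endpoints, symmetric about `1/2`, nondecreasing on `[0,1/2]`, and satisfying the Harnack
inequality `u(t) ≥ φ(t)‖u‖` on `[0,1/2]`. -/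
def memK (u : ℝ → ℝ) : Prop :=
  (∀ t ∈ Icc (0:ℝ) 1, DifferentiableAt ℝ u t) ∧
  ContinuousOn (deriv u) (Icc (0:ℝ) 1) ∧
  u 0 = 0 ∧ u 1 = 0 ∧
  (∀ t ∈ Icc (0:ℝ) 1, u t = u (1 - t)) ∧
  MonotoneOn u (Icc (0:ℝ) (1/2)) ∧
  (∀ t ∈ Icc (0:ℝ) (1/2), phi t * normH u ≤ u t)

/-- Green's function of `-u''` with Dirichlet boundary conditions on `[0,1]`. -/
noncomputable def G (t s : ℝ) : ℝ := if s ≤ t then s * (1 - t) else t * (1 - s)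

open MeasureTheory intervalIntegral

lemma intervalIntegrable_of_abs_le {p : ℝ → ℝ} {B : ℝ} (hp : Measurable p)
    (hpB : ∀ s, |p s| ≤ B) (a b : ℝ) : IntervalIntegrable p volume a b :=
  (intervalIntegrable_const (c := B)).mono_fun hp.aestronglyMeasurable
    (.of_forall fun s => (hpB s).trans (le_abs_self B))

/-- Reduction of a weighted integral to an iterated one, by parts. -/
lemma integral_sub_mul_eq_integral_integral {h : ℝ → ℝ}
    (hI : ∀ a b, IntervalIntegrable h volume a b) (t b : ℝ) :
    ∫ s in t..b, (s - t) * h s = ∫ x in t..b, ∫ s in x..b, h s := by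
  have hF : AbsolutelyContinuousOnInterval (fun x : ℝ => x - t) t b :=
    ((LipschitzWith.id.sub (LipschitzWith.const t)).lipschitzOnWith
      (s := uIcc t b)).absolutelyContinuousOnInterval
  have hH : AbsolutelyContinuousOnInterval (fun x => ∫ s in b..x, h s) t b :=
    (hI t b).absolutelyContinuousOnInterval_intervalIntegral right_mem_uIcc
  have key := hF.integral_mul_deriv_eq_deriv_mul hH
  have e : ∫ s in t..b, (s - t) * deriv (fun x => ∫ s in b..x, h s) s
      = ∫ s in t..b, (s - t) * h s := by
    apply intervalIntegral.integral_congr_ae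
    filter_upwards [(hI t b).ae_hasDerivAt_integral] with x hx hx'
    rw [(hx (uIoc_subset_uIcc hx') b right_mem_uIcc).deriv]
  rw [e] at key
  rw [key]
  simp only [integral_same, sub_self, mul_zero, zero_mul, zero_sub, deriv_sub_const, deriv_id'',
    one_mul]
  rw [← intervalIntegral.integral_neg]
  exact integral_congr fun x _ => by rw [integral_symm x b]; exact neg_neg _

/-- The derivative of the symmetric solution of `-u'' = h`, `u(0) = u(1) = 0`. -/
noncomputable def flux (h : ℝ → ℝ) (t : ℝ) : ℝ := ∫ s in t..(1 / 2), h s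

/-- The symmetric solution of `-u'' = h`, `u(0) = u(1) = 0`. -/
noncomputable def potential (h : ℝ → ℝ) (t : ℝ) : ℝ := ∫ x in (0:ℝ)..t, flux h x

section Potential

variable {h : ℝ → ℝ}

lemma continuous_flux (hI : ∀ a b, IntervalIntegrable h volume a b) : Continuous (flux h) := by
  have : flux h = fun t => -∫ s in (1 / 2)..t, h s := by
    ext t
    rw [flux, integral_symm]
  rw [this]
  exact (continuous_primitive hI _).neg

lemma hasDerivAt_potential (hI : ∀ a b, IntervalIntegrable h volume a b) (t : ℝ) :
    HasDerivAt (potential h) (flux h t) t :=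
  (continuous_flux hI).integral_hasStrictDerivAt 0 t |>.hasDerivAt

lemma deriv_potential (hI : ∀ a b, IntervalIntegrable h volume a b) :
    deriv (potential h) = flux h :=
  funext fun t => (hasDerivAt_potential hI t).deriv

lemma flux_one_sub (hS : ∀ s, h (1 - s) = h s) (t : ℝ) : flux h (1 - t) = -flux h t := by
  have := integral_comp_sub_left (a := t) (b := 1 / 2) h 1
  simp only [hS] at this
  rw [flux, flux, this, integral_symm]
  norm_num

lemma potential_one_sub (hI : ∀ a b, IntervalIntegrable h volume a b)
    (hS : ∀ s, h (1 - s) = h s) (t : ℝ) : potential h (1 - t) = potential h t := by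
  have hc := continuous_flux hI
  have e1 : ∫ x in t..(1 - t), flux h x = 0 := by
    have := integral_comp_sub_left (a := t) (b := 1 - t) (flux h) 1
    simp only [flux_one_sub hS, sub_sub_cancel, intervalIntegral.integral_neg] at this
    linarith
  have e2 := integral_add_adjacent_intervals (hc.intervalIntegrable (μ := volume) 0 t)
    (hc.intervalIntegrable t (1 - t))
  rw [potential, potential]
  linarith

lemma flux_sub_flux (hI : ∀ a b, IntervalIntegrable h volume a b) (x y : ℝ) :
    flux h x - flux h y = ∫ s in x..y, h s := by
  rw [flux, flux, ← integral_add_adjacent_intervals (hI x y) (hI y (1 / 2))]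
  ring

lemma potential_sub_potential (hI : ∀ a b, IntervalIntegrable h volume a b) (x y : ℝ) :
    potential h y - potential h x = ∫ s in x..y, flux h s := by
  have hc := continuous_flux hI
  rw [potential, potential, ← integral_add_adjacent_intervals
    (hc.intervalIntegrable (μ := volume) 0 x) (hc.intervalIntegrable x y)]
  ring

lemma integral_id_mul_eq (hI : ∀ a b, IntervalIntegrable h volume a b) (t : ℝ) :
    ∫ s in (0:ℝ)..t, s * h s = potential h t - t * flux h t := by
  have := integral_sub_mul_eq_integral_integral hI 0 t
  simp only [sub_zero, ← flux_sub_flux hI] at this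
  rw [this, intervalIntegral.integral_sub ((continuous_flux hI).intervalIntegrable _ _)
    (by simp), potential]
  simp

lemma potential_eq_integral_green (hI : ∀ a b, IntervalIntegrable h volume a b)
    (hS : ∀ s, h (1 - s) = h s) {t : ℝ} (ht : t ∈ Icc (0:ℝ) 1) :
    potential h t = ∫ s in (0:ℝ)..1, G t s * h s := by
  have i1 : IntervalIntegrable (fun s => (1 - t) * (s * h s)) volume 0 t :=
    ((hI 0 t).continuousOn_mul continuousOn_id).const_mul _
  have i2 : IntervalIntegrable (fun s => t * ((1 - s) * h s)) volume t 1 :=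
    ((hI t 1).continuousOn_mul (continuous_const.sub continuous_id).continuousOn).const_mul _
  have c1 : ∀ s ∈ uIoc 0 t, (1 - t) * (s * h s) = G t s * h s := by
    intro s hs
    rw [uIoc_of_le ht.1] at hs
    rw [G, if_pos hs.2]
    ring
  have c2 : ∀ s ∈ uIoc t 1, t * ((1 - s) * h s) = G t s * h s := by
    intro s hs
    rw [uIoc_of_le ht.2] at hs
    rw [G, if_neg (not_le.2 hs.1)]
    ring
  rw [← integral_add_adjacent_intervals (i1.congr c1) (i2.congr c2),
    ← intervalIntegral.integral_congr_ae (.of_forall c1),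
    ← intervalIntegral.integral_congr_ae (.of_forall c2),
    intervalIntegral.integral_const_mul, intervalIntegral.integral_const_mul,
    integral_id_mul_eq hI]
  have e : ∫ s in t..1, (1 - s) * h s = ∫ s in (0:ℝ)..(1 - t), s * h s := by
    have := integral_comp_sub_left (a := t) (b := 1) (fun s => s * h s) 1
    simpa only [hS, sub_self] using this
  rw [e, integral_id_mul_eq hI, potential_one_sub hI hS, flux_one_sub hS]
  ring

lemma flux_half : flux h (1 / 2) = 0 := by simp [flux]

lemma antitone_flux (hI : ∀ a b, IntervalIntegrable h volume a b) (h0 : ∀ s, 0 ≤ h s) :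
    Antitone (flux h) := by
  intro x y hxy
  have : 0 ≤ ∫ s in x..y, h s := integral_nonneg hxy fun s _ => h0 s
  rw [← flux_sub_flux hI] at this
  linarith

lemma flux_nonneg (hI : ∀ a b, IntervalIntegrable h volume a b) (h0 : ∀ s, 0 ≤ h s) {t : ℝ}
    (ht : t ≤ 1 / 2) : 0 ≤ flux h t :=
  flux_half (h := h) ▸ antitone_flux hI h0 ht

lemma monotoneOn_potential (hI : ∀ a b, IntervalIntegrable h volume a b) (h0 : ∀ s, 0 ≤ h s) :
    MonotoneOn (potential h) (Iic (1 / 2)) := by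
  intro x _ y hy hxy
  have : 0 ≤ ∫ s in x..y, flux h s :=
    integral_nonneg hxy fun s hs => flux_nonneg hI h0 (hs.2.trans hy)
  rw [← potential_sub_potential hI] at this
  linarith

lemma mul_flux_le_potential (hI : ∀ a b, IntervalIntegrable h volume a b) (h0 : ∀ s, 0 ≤ h s)
    {t : ℝ} (ht : 0 ≤ t) : t * flux h t ≤ potential h t := by
  have := integral_mono_on (μ := volume) ht (by simp : IntervalIntegrable (fun _ => flux h t) _ 0 t)
    ((continuous_flux hI).intervalIntegrable _ _) fun s hs => antitone_flux hI h0 hs.2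
  simpa [potential] using this

lemma le_flux (hI : ∀ a b, IntervalIntegrable h volume a b)
    (hm : MonotoneOn h (Icc 0 (1 / 2))) {t : ℝ} (ht : t ∈ Icc (0:ℝ) (1 / 2)) :
    (1 - 2 * t) * flux h 0 ≤ flux h t := by
  have A : flux h 0 - flux h t ≤ t * h t := by
    rw [flux_sub_flux hI]
    have := integral_mono_on (μ := volume) ht.1 (hI 0 t)
      (by simp : IntervalIntegrable (fun _ => h t) _ 0 t)
      fun s hs => hm ⟨hs.1, hs.2.trans ht.2⟩ ht hs.2
    simpa using this
  have B : (1 / 2 - t) * h t ≤ flux h t := by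
    have := integral_mono_on (μ := volume) ht.2
      (by simp : IntervalIntegrable (fun _ => h t) _ t (1 / 2)) (hI t (1 / 2))
      fun s hs => hm ht ⟨ht.1.trans hs.1, hs.2⟩ hs.1
    simpa [flux] using this
  have h1 := mul_le_mul_of_nonneg_left A (by linarith [ht.2] : 0 ≤ 1 - 2 * t)
  have h2 := mul_le_mul_of_nonneg_left B (by linarith [ht.1] : 0 ≤ 2 * t)
  linarith

lemma normH_potential (hI : ∀ a b, IntervalIntegrable h volume a b) :
    normH (potential h) = √(∫ t in (0:ℝ)..1, flux h t ^ 2) := by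
  rw [normH, deriv_potential hI]

lemma normH_potential_le (hI : ∀ a b, IntervalIntegrable h volume a b) (h0 : ∀ s, 0 ≤ h s)
    (hS : ∀ s, h (1 - s) = h s) : normH (potential h) ≤ flux h 0 := by
  rw [normH_potential hI]
  refine Real.sqrt_le_iff.2 ⟨flux_nonneg hI h0 (by norm_num), ?_⟩
  have h1 : flux h 1 = -flux h 0 := by simpa using flux_one_sub hS 0
  have := integral_mono_on (μ := volume) zero_le_one
    (((continuous_flux hI).pow 2).intervalIntegrable _ _)
    (by simp : IntervalIntegrable (fun _ => flux h 0 ^ 2) _ 0 1) fun s hs => by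
      apply sq_le_sq' _ (antitone_flux hI h0 hs.1)
      rw [← h1]
      exact antitone_flux hI h0 hs.2
  simpa using this

lemma phi_mul_normH_le (hI : ∀ a b, IntervalIntegrable h volume a b) (h0 : ∀ s, 0 ≤ h s)
    (hS : ∀ s, h (1 - s) = h s) (hm : MonotoneOn h (Icc 0 (1 / 2))) {t : ℝ}
    (ht : t ∈ Icc (0:ℝ) (1 / 2)) : phi t * normH (potential h) ≤ potential h t := by
  have hphi : 0 ≤ phi t := mul_nonneg ht.1 (by linarith [ht.2])
  calc phi t * normH (potential h) ≤ phi t * flux h 0 :=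
        mul_le_mul_of_nonneg_left (normH_potential_le hI h0 hS) hphi
    _ = t * ((1 - 2 * t) * flux h 0) := by rw [phi]; ring
    _ ≤ t * flux h t := mul_le_mul_of_nonneg_left (le_flux hI hm ht) ht.1
    _ ≤ potential h t := mul_flux_le_potential hI h0 ht.1

lemma two_mul_potential_half_le (hI : ∀ a b, IntervalIntegrable h volume a b)
    (hS : ∀ s, h (1 - s) = h s) : 2 * potential h (1 / 2) ≤ normH (potential h) := by
  rw [normH_potential hI]
  apply Real.le_sqrt_of_sq_le
  have hc := continuous_flux hI
  set c := 2 * potential h (1 / 2) with hcdef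
  have i2 : ∀ a b, IntervalIntegrable (fun t => flux h t ^ 2) volume a b :=
    fun a b => (hc.pow 2).intervalIntegrable a b
  have hsym : ∫ t in (1 / 2)..1, flux h t ^ 2 = ∫ t in (0:ℝ)..(1 / 2), flux h t ^ 2 := by
    have := integral_comp_sub_left (a := 1 / 2) (b := 1) (fun t => flux h t ^ 2) 1
    simp only [flux_one_sub hS, neg_sq] at this
    rw [this]
    norm_num
  have hadd := integral_add_adjacent_intervals (i2 0 (1 / 2)) (i2 (1 / 2) 1)
  have hsq : 0 ≤ ∫ t in (0:ℝ)..(1 / 2), (flux h t ^ 2 - 2 * c * flux h t + c ^ 2) :=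
    integral_nonneg (by norm_num) fun t _ => by nlinarith [sq_nonneg (flux h t - c)]
  rw [intervalIntegral.integral_add ((i2 _ _).sub ((hc.intervalIntegrable _ _).const_mul _))
    (by simp), intervalIntegral.integral_sub (i2 _ _) ((hc.intervalIntegrable _ _).const_mul _),
    intervalIntegral.integral_const_mul, intervalIntegral.integral_const, smul_eq_mul,
    ← potential] at hsq
  nlinarith

lemma memK_potential (hI : ∀ a b, IntervalIntegrable h volume a b) (h0 : ∀ s, 0 ≤ h s)
    (hS : ∀ s, h (1 - s) = h s) (hm : MonotoneOn h (Icc 0 (1 / 2))) : memK (potential h) := by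
  have hp0 : potential h 0 = 0 := by simp [potential]
  refine ⟨fun t _ => (hasDerivAt_potential hI t).differentiableAt, ?_, hp0, ?_,
    fun t _ => (potential_one_sub hI hS t).symm, ?_, fun t ht => phi_mul_normH_le hI h0 hS hm ht⟩
  · rw [deriv_potential hI]
    exact (continuous_flux hI).continuousOn
  · simpa [hp0] using potential_one_sub hI hS 0
  · exact (monotoneOn_potential hI h0).mono Icc_subset_Iic_self

end Potential

/-- Solutions of `-w'' = p φ(w)`, `w'(1/2) = 0`, `w(1/2) = a` exist and depend continuously
on `a`. -/
lemma exists_continuous_volterra {p φ : ℝ → ℝ} {B : ℝ} {L : NNReal} (hp : Measurable p)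
    (hpB : ∀ s, |p s| ≤ B) (hφ : LipschitzWith L φ) :
    ∃ w : ℝ → ℝ → ℝ, (∀ a, Continuous (w a)) ∧
      (∀ a, ∀ t ∈ Icc (0:ℝ) (1 / 2),
        w a t = a - ∫ s in t..(1 / 2), (s - t) * (p s * φ (w a s))) ∧
      Continuous fun a => w a 0 := by
  have hhalf : (0:ℝ) ≤ 1 / 2 := by norm_num
  have hB : 0 ≤ B := (abs_nonneg _).trans (hpB 0)
  obtain ⟨k, hk⟩ : ∃ k : ℝ, k = B * L + 1 := ⟨_, rfl⟩
  have hk0 : 0 < k := by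
    have := mul_nonneg hB L.2
    rw [hk]
    exact add_pos_of_nonneg_of_pos this one_pos
  have hpI : ∀ a b, IntervalIntegrable p volume a b := intervalIntegrable_of_abs_le hp hpB
  let W : C(Icc (0:ℝ) (1 / 2), ℝ) → ℝ → ℝ := fun v s =>
    Real.exp (k * (1 / 2 - s)) * v (projIcc 0 (1 / 2) hhalf s)
  have hW : ∀ v, Continuous (W v) := fun v =>
    (by fun_prop : Continuous fun s => Real.exp (k * (1 / 2 - s))).mul
      (v.continuous.comp continuous_projIcc)
  have hI : ∀ v a b, IntervalIntegrable (fun s => p s * φ (W v s)) volume a b := fun v a b =>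
    (hpI a b).mul_continuousOn (hφ.continuous.comp (hW v)).continuousOn
  have hJ : ∀ v t a b, IntervalIntegrable (fun s => (s - t) * (p s * φ (W v s))) volume a b :=
    fun v t a b => (hI v a b).continuousOn_mul (by fun_prop)
  have hC : ∀ v, Continuous fun t => ∫ s in t..(1 / 2), (s - t) * (p s * φ (W v s)) := by
    intro v
    simp only [integral_sub_mul_eq_integral_integral (hI v)]
    exact continuous_flux (h := flux _) fun a b =>
      (continuous_flux (hI v)).intervalIntegrable a b
  let T : ℝ → C(Icc (0:ℝ) (1 / 2), ℝ) → C(Icc (0:ℝ) (1 / 2), ℝ) := fun a v =>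
    ⟨fun t => Real.exp (-(k * (1 / 2 - t))) *
      (a - ∫ s in (t:ℝ)..(1 / 2), (s - t) * (p s * φ (W v s))),
      (by fun_prop : Continuous fun t : Icc (0:ℝ) (1 / 2) =>
        Real.exp (-(k * (1 / 2 - (t:ℝ))))).mul
        (continuous_const.sub ((hC v).comp continuous_subtype_val))⟩
  have hT : ∀ a, ContractingWith (1 / 2) (T a) := by
    intro a
    refine ⟨by norm_num, LipschitzWith.of_dist_le_mul fun v₁ v₂ => ?_⟩
    rw [ContinuousMap.dist_le (by positivity)]
    intro t
    have ht := t.2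
    have hd : ∀ s, |φ (W v₂ s) - φ (W v₁ s)|
        ≤ L * (Real.exp (k * (1 / 2 - s)) * dist v₁ v₂) := by
      intro s
      have h1 := hφ.dist_le_mul (W v₂ s) (W v₁ s)
      rw [Real.dist_eq] at h1
      refine h1.trans (mul_le_mul_of_nonneg_left ?_ L.2)
      rw [Real.dist_eq, ← mul_sub, abs_mul, abs_of_pos (Real.exp_pos _), dist_comm]
      exact mul_le_mul_of_nonneg_left (by
        rw [← Real.dist_eq]
        exact ContinuousMap.dist_apply_le_dist _) (Real.exp_pos _).le
    have e : (T a v₁) t - (T a v₂) t = ∫ s in (t:ℝ)..(1 / 2),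
        Real.exp (-(k * (1 / 2 - t))) *
          ((s - t) * (p s * (φ (W v₂ s) - φ (W v₁ s)))) := by
      rw [intervalIntegral.integral_const_mul]
      simp only [T, ContinuousMap.coe_mk, ← mul_sub]
      congr 1
      rw [sub_sub_sub_cancel_left, ← intervalIntegral.integral_sub (hJ _ _ _ _) (hJ _ _ _ _)]
      congr 1
      ext s
      ring
    rw [Real.dist_eq, e, ← Real.norm_eq_abs]
    have hb := norm_integral_le_of_norm_le_const (a := (t:ℝ)) (b := 1 / 2) (C := dist v₁ v₂)
      (f := fun s => Real.exp (-(k * (1 / 2 - t))) *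
          ((s - t) * (p s * (φ (W v₂ s) - φ (W v₁ s))))) (by
        intro s hs
        rw [uIoc_of_le ht.2] at hs
        have hst : 0 ≤ s - t := by linarith [hs.1]
        rw [Real.norm_eq_abs, abs_mul, abs_mul, abs_mul, abs_of_pos (Real.exp_pos _),
          abs_of_nonneg hst]
        have hexp : Real.exp (-(k * (1 / 2 - t))) * Real.exp (k * (1 / 2 - s))
            = Real.exp (-(k * (s - t))) := by
          rw [← Real.exp_add]
          congr 1
          ring
        have hx : k * (s - t) * Real.exp (-(k * (s - t))) ≤ 1 := by
          rw [Real.exp_neg, ← div_eq_mul_inv, div_le_one (Real.exp_pos _)]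
          linarith [Real.add_one_le_exp (k * (s - t))]
        have hD : 0 ≤ dist v₁ v₂ := dist_nonneg
        calc Real.exp (-(k * (1 / 2 - t))) *
              ((s - t) * (|p s| * |φ (W v₂ s) - φ (W v₁ s)|))
            ≤ Real.exp (-(k * (1 / 2 - t))) *
              ((s - t) * (B * (L * (Real.exp (k * (1 / 2 - s)) * dist v₁ v₂)))) := by
              gcongr
              · exact hpB s
              · exact hd s
          _ = (Real.exp (-(k * (1 / 2 - t))) * Real.exp (k * (1 / 2 - s))) * (s - t) *
              (B * L) * dist v₁ v₂ := by ring
          _ ≤ 1 * dist v₁ v₂ := by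
              rw [hexp]
              refine mul_le_mul_of_nonneg_right ?_ hD
              have h2 : 0 ≤ (s - t) * Real.exp (-(k * (s - t))) := by positivity
              rw [hk] at hx h2 ⊢
              nlinarith
          _ = dist v₁ v₂ := one_mul _)
    refine hb.trans ?_
    rw [abs_of_nonneg (by linarith [ht.2]), mul_comm]
    refine mul_le_mul_of_nonneg_right ?_ dist_nonneg
    have h0 := ht.1
    push_cast
    linarith
  have hab : ∀ a b v, dist (T a v) (T b v) ≤ |a - b| := by
    intro a b v
    rw [ContinuousMap.dist_le (abs_nonneg _)]
    intro t
    have ht := t.2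
    have e : (T a v) t - (T b v) t = Real.exp (-(k * (1 / 2 - t))) * (a - b) := by
      simp only [T, ContinuousMap.coe_mk]
      ring
    rw [Real.dist_eq, e, abs_mul, abs_of_pos (Real.exp_pos _)]
    refine mul_le_of_le_one_left (abs_nonneg _) (Real.exp_le_one_iff.2 ?_)
    have : 0 ≤ k * (1 / 2 - t) := mul_nonneg hk0.le (by linarith [ht.2])
    linarith
  let V : ℝ → C(Icc (0:ℝ) (1 / 2), ℝ) := fun a => ContractingWith.fixedPoint (T a) (hT a)
  have hV : ∀ a, T a (V a) = V a := fun a => (hT a).fixedPoint_isFixedPt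
  have hVc : Continuous V := by
    refine (LipschitzWith.of_dist_le_mul (K := 2) fun a b => ?_).continuous
    refine ((hT a).dist_fixedPoint_fixedPoint_of_dist_le' (T b) (hV a) (hV b) (hab a b)).trans ?_
    rw [Real.dist_eq]
    apply le_of_eq
    push_cast
    ring
  refine ⟨fun a => W (V a), fun a => hW _, fun a t ht => ?_, ?_⟩
  · have h1 : V a ⟨t, ht⟩ = Real.exp (-(k * (1 / 2 - t))) *
        (a - ∫ s in t..(1 / 2), (s - t) * (p s * φ (W (V a) s))) :=
      (DFunLike.congr_fun (hV a) ⟨t, ht⟩).symm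
    calc W (V a) t = Real.exp (k * (1 / 2 - t)) * V a ⟨t, ht⟩ := by
          simp only [W, projIcc_of_mem hhalf ht]
      _ = _ := by
          rw [h1, ← mul_assoc, ← Real.exp_add, add_neg_cancel, Real.exp_zero, one_mul]
  · exact continuous_const.mul
      ((ContinuousEvalConst.continuous_eval_const (projIcc 0 (1 / 2) hhalf 0)).comp hVc)

/-- The folding of the line onto `[0,1/2]` by the reflection `s ↦ 1 - s`. -/
noncomputable def fold (s : ℝ) : ℝ := max 0 (min s (1 - s))

lemma continuous_fold : Continuous fold := by
  unfold fold
  fun_prop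

lemma fold_one_sub (s : ℝ) : fold (1 - s) = fold s := by
  rw [fold, fold, sub_sub_cancel, min_comm]

lemma fold_mem (s : ℝ) : fold s ∈ Icc (0:ℝ) (1 / 2) := by
  refine ⟨le_max_left _ _, max_le (by norm_num) ?_⟩
  rcases le_total s (1 / 2) with h | h
  · exact (min_le_left _ _).trans h
  · exact (min_le_right _ _).trans (by linarith)

lemma fold_of_mem {s : ℝ} (hs : s ∈ Icc (0:ℝ) (1 / 2)) : fold s = s := by
  rw [fold, min_eq_left (by linarith [hs.2]), max_eq_right hs.1]

/-- A symmetric function on `[0,1]` factors through the folding. -/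
lemma apply_fold_eq {k : ℝ → ℝ} (hk : ∀ t ∈ Icc (0:ℝ) (1 / 2), k t = k (1 - t)) {s : ℝ}
    (hs : s ∈ Icc (0:ℝ) 1) : k (fold s) = k s := by
  rcases le_total s (1 / 2) with h | h
  · rw [fold_of_mem ⟨hs.1, h⟩]
  · have h1 : 1 - s ∈ Icc (0:ℝ) (1 / 2) := ⟨by linarith [hs.2], by linarith⟩
    rw [← fold_one_sub, fold_of_mem h1, hk _ h1, sub_sub_cancel]

/-- Cauchy-Schwarz bound for the first moment of a symmetric function, with a slightly
non-optimal constant. -/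
lemma integral_id_mul_le_sqrt {p : ℝ → ℝ}
    (hI : ∀ a b, IntervalIntegrable p volume a b)
    (hI2 : ∀ a b, IntervalIntegrable (fun s => p s ^ 2) volume a b)
    (hS : ∀ s, p (1 - s) = p s) (hpos : 0 < √(∫ s in (0:ℝ)..1, p s ^ 2)) :
    ∫ s in (0:ℝ)..(1 / 2), s * p s ≤ 7 / 48 * √(∫ s in (0:ℝ)..1, p s ^ 2) := by
  have hA := Real.sq_sqrt (Real.sqrt_pos.1 hpos).le
  set A := √(∫ s in (0:ℝ)..1, p s ^ 2)
  have hsym : ∫ s in (1 / 2)..1, p s ^ 2 = ∫ s in (0:ℝ)..(1 / 2), p s ^ 2 := by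
    have := integral_comp_sub_left (a := 1 / 2) (b := 1) (fun s => p s ^ 2) 1
    simp only [hS] at this
    rw [this]
    norm_num
  have hadd := integral_add_adjacent_intervals (hI2 0 (1 / 2)) (hI2 (1 / 2) 1)
  have hi1 : IntervalIntegrable (fun s => 8 * A * (s * p s)) volume 0 (1 / 2) :=
    ((hI _ _).continuousOn_mul continuousOn_id).const_mul _
  have hi2 : IntervalIntegrable (fun s : ℝ => 16 * A ^ 2 * s ^ 2) volume 0 (1 / 2) :=
    (by fun_prop : Continuous fun s : ℝ => 16 * A ^ 2 * s ^ 2).intervalIntegrable _ _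
  have hle := integral_mono_on (μ := volume) (by norm_num) hi1 (hi2.add (hI2 0 (1 / 2)))
    fun s _ => by nlinarith [sq_nonneg (4 * A * s - p s)]
  rw [intervalIntegral.integral_add hi2 (hI2 _ _), intervalIntegral.integral_const_mul,
    intervalIntegral.integral_const_mul, integral_pow] at hle
  norm_num at hle hsym hadd ⊢
  have h3 : A * (8 * ∫ s in (0:ℝ)..(1 / 2), s * p s) ≤ A * (7 / 6 * A) := by
    norm_num
    nlinarith
  have := le_of_mul_le_mul_left h3 hpos
  norm_num at this
  linarith

/-- Under (H1) and (H4), the Dirichlet problem `-u'' = g f(u)`,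
`u(0) = u(1) = 0`, has a positive symmetric solution localized in the annular
conical set `{ u ∈ K : r < ‖u‖ < R }`. -/
theorem dirichlet_solution_of_H1_H4
    (f : ℝ → ℝ) (hf : ContDiff ℝ 1 f)
    (hfmono : MonotoneOn f (Ici (0:ℝ)))
    (hf0 : 0 ≤ f 0) (hfpos : ∀ t : ℝ, 0 < t → 0 < f t)
    (g : ℝ → ℝ) (hgnonneg : ∀ t ∈ Icc (0:ℝ) 1, 0 ≤ g t)
    (hgbdd : ∃ M : ℝ, ∀ t ∈ Icc (0:ℝ) 1, g t ≤ M)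
    (hgmeas : Measurable g)
    (hgmono : MonotoneOn g (Icc (0:ℝ) (1/2)))
    (hgsymm : ∀ t ∈ Icc (0:ℝ) (1/2), g t = g (1 - t))
    (r R : ℝ) (hr : 0 < r) (hrR : r < R)
    (β : ℝ) (hβ : β ∈ Ioo (0:ℝ) (1/4))
    (Atil Ctil : ℝ)
    (hAtil : Atil = Real.sqrt (∫ t in (0:ℝ)..1, g t ^ 2))
    (hCtil : Ctil = ∫ t in β..(1/2:ℝ), g t)
    -- condition (H1)
    (hApos : 0 < Atil) (hCpos : 0 < Ctil)
    (hH1r : f r / r < Real.pi / Atil)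
    (hH1R : f (R * phi β) / R > 1 / (2 * phi β * Ctil))
    -- condition (H4)
    (hg0 : ∀ t ∈ Icc (0:ℝ) β, g t = 0)
    (f'' : ℝ → ℝ) (hf''cont : ContinuousOn f'' (Icc (r * phi β) R))
    (hf'' : ∀ t ∈ Icc (r * phi β) R, HasDerivWithinAt (deriv f) (f'' t) (Icc (r * phi β) R) t)
    (M : ℝ) (hM : 0 < M) (hf''M : ∀ t ∈ Icc (r * phi β) R, M ≤ f'' t)
    (θtil : ℝ → ℝ) (hθcont : ContinuousOn θtil (Icc (r * phi β) R))
    (hθpos : ∀ t ∈ Icc (r * phi β) R, 0 < θtil t)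
    (hARtil : ∀ t ∈ Icc (r * phi β) R, θtil t ≤ t * deriv f t - f t) :
    ∃ u : ℝ → ℝ, memK u ∧ r < normH u ∧ normH u < R ∧
      ∀ t ∈ Icc (0:ℝ) 1, u t = ∫ s in (0:ℝ)..1, G t s * f (u s) * g s := by
  have hR : 0 < R := hr.trans hrR
  obtain ⟨hβ0, hβ4⟩ := hβ
  have hphi : 0 < phi β := mul_pos hβ0 (by linarith)
  have hphi2 : 2 * phi β ≤ 1 := by
    rw [phi]
    nlinarith
  have hβm : β ∈ Icc (0:ℝ) (1 / 2) := ⟨hβ0.le, by linarith⟩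
  have hhalf : (1 / 2 : ℝ) ∈ Icc (0:ℝ) (1 / 2) := by norm_num
  have hzero : (0 : ℝ) ∈ Icc (0:ℝ) (1 / 2) := by norm_num
  have hfnn : ∀ x, 0 ≤ x → 0 ≤ f x := fun x hx => hf0.trans (hfmono self_mem_Ici hx hx)
  -- truncation of the nonlinearity
  obtain ⟨L, hL⟩ := (hf.locallyLipschitz.locallyLipschitzOn
    (s := Icc 0 R)).exists_lipschitzOnWith_of_compact isCompact_Icc
  let φ : ℝ → ℝ := fun x => f (projIcc 0 R hR.le x)
  have hφL : LipschitzWith (L * 1) φ :=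
    hL.to_restrict.comp (LipschitzWith.projIcc hR.le)
  have hφ0 : ∀ x, 0 ≤ φ x := fun x => hfnn _ (projIcc 0 R hR.le x).2.1
  have hφm : Monotone φ := fun x y hxy =>
    hfmono (projIcc 0 R hR.le x).2.1 (projIcc 0 R hR.le y).2.1 (monotone_projIcc hR.le hxy)
  have hφf : ∀ x ∈ Icc 0 R, φ x = f x := fun x hx => by
    simp only [φ, projIcc_of_mem hR.le hx]
  -- symmetric extension of the weight
  obtain ⟨B, hB⟩ := hgbdd
  let p : ℝ → ℝ := fun s => g (fold s)
  have hfold1 : ∀ s, fold s ∈ Icc (0:ℝ) 1 := fun s =>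
    ⟨(fold_mem s).1, (fold_mem s).2.trans (by norm_num)⟩
  have hp : Measurable p := hgmeas.comp continuous_fold.measurable
  have hp0 : ∀ s, 0 ≤ p s := fun s => hgnonneg _ (hfold1 s)
  have hpB : ∀ s, |p s| ≤ B := fun s => (abs_of_nonneg (hp0 s)).trans_le (hB _ (hfold1 s))
  have hpS : ∀ s, p (1 - s) = p s := fun s => by simp only [p, fold_one_sub]
  have hpg : ∀ s ∈ Icc (0:ℝ) 1, p s = g s := fun s hs => apply_fold_eq hgsymm hs
  have hpI : ∀ a b, IntervalIntegrable p volume a b := intervalIntegrable_of_abs_le hp hpB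
  have hpI2 : ∀ a b, IntervalIntegrable (fun s => p s ^ 2) volume a b :=
    intervalIntegrable_of_abs_le (hp.pow_const 2) (B := B ^ 2) fun s => by
      rw [abs_pow]
      exact pow_le_pow_left₀ (abs_nonneg _) (hpB s) 2
  -- the shooting family
  obtain ⟨w, hwc, hw, hw0⟩ := exists_continuous_volterra hp hpB hφL
  let H : ℝ → ℝ → ℝ := fun a s => p s * φ (w a (fold s))
  have hI : ∀ a x y, IntervalIntegrable (H a) volume x y := fun a x y =>
    (hpI x y).mul_continuousOn
      (hφL.continuous.comp ((hwc a).comp continuous_fold)).continuousOn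
  have hH0 : ∀ a s, 0 ≤ H a s := fun a s => mul_nonneg (hp0 s) (hφ0 _)
  have hHS : ∀ a s, H a (1 - s) = H a s := fun a s => by simp only [H, hpS, fold_one_sub]
  have hHw : ∀ a, ∀ s ∈ Icc (0:ℝ) (1 / 2), H a s = p s * φ (w a s) := fun a s hs => by
    simp only [H, fold_of_mem hs]
  have hweq : ∀ a, ∀ t ∈ Icc (0:ℝ) (1 / 2), w a t = a - ∫ s in t..(1 / 2), (s - t) * H a s := by
    intro a t ht
    rw [hw a t ht]
    congr 1
    refine integral_congr fun s hs => ?_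
    rw [uIcc_of_le ht.2] at hs
    simp only [hHw a s ⟨ht.1.trans hs.1, hs.2⟩]
  have hwhalf : ∀ a, w a (1 / 2) = a := fun a => by
    rw [hweq a _ hhalf, integral_same, sub_zero]
  have hwU : ∀ a, ∀ t ∈ Icc (0:ℝ) (1 / 2), w a t = w a 0 + potential (H a) t := by
    intro a t ht
    have e1 := hweq a t ht
    have e0 := hweq a 0 hzero
    rw [integral_sub_mul_eq_integral_integral (hI a)] at e1 e0
    have p1 := potential_sub_potential (hI a) t (1 / 2)
    have p0 := potential_sub_potential (hI a) 0 (1 / 2)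
    have pz : potential (H a) 0 = 0 := by simp [potential]
    simp only [flux] at p1 p0
    linarith
  have hwm : ∀ a, MonotoneOn (w a) (Icc 0 (1 / 2)) := fun a x hx y hy hxy => by
    rw [hwU a x hx, hwU a y hy]
    exact add_le_add_right (monotoneOn_potential (hI a) (hH0 a) hx.2 hy.2 hxy) _
  have hHm : ∀ a, MonotoneOn (H a) (Icc 0 (1 / 2)) := fun a x hx y hy hxy => by
    rw [hHw a x hx, hHw a y hy]
    refine mul_le_mul ?_ (hφm (hwm a hx hy hxy)) (hφ0 _) (hp0 y)
    simp only [p, fold_of_mem hx, fold_of_mem hy]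
    exact hgmono hx hy hxy
  have hsplit : ∀ a, a = w a 0 + potential (H a) (1 / 2) := fun a => by
    rw [← hwU a _ hhalf, hwhalf]
  have hharnack : ∀ a, phi β * normH (potential (H a)) ≤ potential (H a) β := fun a =>
    phi_mul_normH_le (hI a) (hH0 a) (hHS a) (hHm a) hβm
  -- small amplitudes do not reach the boundary value
  have hlow : 0 < w (r / 2) 0 := by
    have hAeq : Atil = √(∫ s in (0:ℝ)..1, p s ^ 2) := by
      rw [hAtil]
      congr 1
      refine integral_congr fun s hs => ?_
      rw [uIcc_of_le zero_le_one] at hs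
      simp only [hpg s hs]
    have hmom := integral_id_mul_le_sqrt hpI hpI2 hpS (hAeq ▸ hApos)
    rw [← hAeq] at hmom
    have hle : ∫ s in (0:ℝ)..(1 / 2), s * H (r / 2) s
        ≤ ∫ s in (0:ℝ)..(1 / 2), f r * (s * p s) := by
      refine integral_mono_on (by norm_num) ((hI _ _ _).continuousOn_mul continuousOn_id)
        (((hpI _ _).continuousOn_mul continuousOn_id).const_mul _) fun s hs => ?_
      have h1 : φ (w (r / 2) s) ≤ f r := by
        rw [← hφf r ⟨hr.le, hrR.le⟩]
        apply hφm
        have := hwm (r / 2) hs hhalf hs.2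
        rw [hwhalf] at this
        linarith
      rw [hHw _ s hs]
      have := mul_le_mul_of_nonneg_left h1 (mul_nonneg hs.1 (hp0 s))
      linarith
    rw [intervalIntegral.integral_const_mul] at hle
    have hw0' := hweq (r / 2) 0 hzero
    simp only [sub_zero] at hw0'
    rw [div_lt_div_iff₀ hr hApos] at hH1r
    have h2 := mul_le_mul_of_nonneg_left hmom (hfnn r hr.le)
    have h3 : Real.pi * r < 3.15 * r := mul_lt_mul_of_pos_right Real.pi_lt_d2 hr
    linarith
  have hescape : ∀ a, 0 ≤ w a 0 → R * phi β ≤ w a β → R / 2 < a := by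
    intro a ha hb
    have hRphi : R * phi β ∈ Icc 0 R := ⟨by positivity, by nlinarith⟩
    have hC : f (R * phi β) * Ctil ≤ flux (H a) β := by
      rw [hCtil, ← intervalIntegral.integral_const_mul, flux]
      have hmem : ∀ s ∈ Icc β (1 / 2), s ∈ Icc (0:ℝ) (1 / 2) := fun s hs =>
        ⟨hβ0.le.trans hs.1, hs.2⟩
      have hgI : IntervalIntegrable g volume β (1 / 2) :=
        (hpI β (1 / 2)).congr fun s hs => by
          rw [uIoc_of_le hβm.2] at hs
          exact hpg s ⟨hβ0.le.trans hs.1.le, hs.2.trans (by norm_num)⟩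
      refine integral_mono_on hβm.2 (hgI.const_mul _) (hI _ _ _) fun s hs => ?_
      rw [hHw a s (hmem s hs), ← hφf _ hRphi, ← hpg s ⟨(hmem s hs).1, hs.2.trans (by norm_num)⟩,
        mul_comm]
      exact mul_le_mul_of_nonneg_left (hφm (hb.trans (hwm a hβm (hmem s hs) hs.1))) (hp0 s)
    have h1 := mul_flux_le_potential (hI a) (hH0 a) hβ0.le
    have h2 := mul_le_mul_of_nonneg_left hC hβ0.le
    have h3 : R < 2 * (β * (f (R * phi β) * Ctil)) := by
      rw [gt_iff_lt, div_lt_div_iff₀ (by positivity) hR] at hH1R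
      have hnn : 0 ≤ β * (f (R * phi β) * Ctil) :=
        mul_nonneg hβ0.le (mul_nonneg (hfnn _ hRphi.1) hCpos.le)
      have e : f (R * phi β) * (2 * phi β * Ctil)
          = 2 * (β * (f (R * phi β) * Ctil)) * (1 - 2 * β) := by
        generalize f (R * phi β) = y
        rw [phi]
        ring
      nlinarith
    have h4 := hwm a hβm hhalf hβm.2
    rw [hwhalf, hwU a β hβm] at h4
    linarith
  -- large amplitudes overshoot the boundary value
  have hhigh : w (R / 2) 0 < 0 := by
    by_contra! hcon
    refine lt_irrefl _ (hescape _ hcon ?_)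
    have h1 := mul_le_mul_of_nonneg_left
      (two_mul_potential_half_le (hI (R / 2)) (hHS (R / 2))) hphi.le
    have h2 := hharnack (R / 2)
    have h3 := hsplit (R / 2)
    rw [hwU _ β hβm]
    have h4 := mul_le_mul_of_nonneg_right hphi2 hcon
    have h5 : R * phi β = 2 * phi β * w (R / 2) 0
        + phi β * (2 * potential (H (R / 2)) (1 / 2)) := by
      linear_combination 2 * phi β * h3
    linarith
  obtain ⟨a, ha, ha0⟩ := intermediate_value_Icc' (by linarith : r / 2 ≤ R / 2) hw0.continuousOn
    (show (0:ℝ) ∈ Icc (w (R / 2) 0) (w (r / 2) 0) from ⟨hhigh.le, hlow.le⟩)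
  simp only at ha0
  have hra : r / 2 < a := lt_of_le_of_ne ha.1 fun h => by rw [← h] at ha0; linarith
  have hUw : ∀ t ∈ Icc (0:ℝ) (1 / 2), w a t = potential (H a) t := fun t ht => by
    rw [hwU a t ht, ha0, zero_add]
  refine ⟨potential (H a), memK_potential (hI a) (hH0 a) (hHS a) (hHm a), ?_, ?_, ?_⟩
  · have h1 := two_mul_potential_half_le (hI a) (hHS a)
    rw [← hUw _ hhalf, hwhalf] at h1
    linarith
  · by_contra! hcon
    refine (hescape a ha0.ge ?_).not_ge ha.2
    rw [hUw β hβm, mul_comm]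
    exact (mul_le_mul_of_nonneg_left hcon hphi.le).trans (hharnack a)
  · intro t ht
    rw [potential_eq_integral_green (hI a) (hHS a) ht]
    refine integral_congr fun s hs => ?_
    rw [uIcc_of_le zero_le_one] at hs
    have e1 : w a (fold s) = potential (H a) s := by
      rw [hUw _ (fold_mem s)]
      exact apply_fold_eq (fun t _ => (potential_one_sub (hI a) (hHS a) t).symm) hs
    have e2 : potential (H a) s ∈ Icc 0 R := by
      rw [← e1]
      have l := hwm a hzero (fold_mem s) (fold_mem s).1
      have u := hwm a (fold_mem s) hhalf (fold_mem s).2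
      rw [ha0] at l
      rw [hwhalf] at u
      exact ⟨l, by linarith [ha.2]⟩
    simp only [H]
    rw [e1, hφf _ e2, hpg s hs]
    ring
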